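/- For all integers n ≥ 1 and k ≥ 1, Σ_{m=1}^{k} (-1)^{m-1} m · 2^k · σ_m(T_1, ..., T_n) · h_{k-m}(T_1, ..., T_n) = (-1)^k / ((k+1) C(2k+2, k+1)) + Σ_{j=0}^{k} C(k, j) B_{k+j+1}(n+1)/(k+j+1), where T_j = j(j+1)/2 is the j-th triangular number. -/

import Mathlib

/-- The `m`-th elementary symmetric function of the family `f` over the finite index set `s`:
the sum over all `m`-element subsets of `s` of the product of the values of `f`. -/
def esymmOn {ι R : Type*} [CommRing R] (s : Finset ι) (m : ℕ) (f : ι → R) : R :=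
  ∑ t ∈ s.powersetCard m, ∏ i ∈ t, f i

/-- The `m`-th complete homogeneous symmetric function of the family `f` over the finite
index set `s`: the sum over all multisets of elements of `s` of size `m` of the product
of the values of `f` (with multiplicity). -/
def hsymmOn {ι R : Type*} [DecidableEq ι] [CommRing R] (s : Finset ι) (m : ℕ) (f : ι → R) : R :=
  ∑ t ∈ s.sym m, ((t : Multiset ι).map f).prod

open Finset

section SymmetricFunctions

variable {ι R : Type*} [CommRing R]

theorem esymmOn_zero (s : Finset ι) (f : ι → R) : esymmOn s 0 f = 1 := by
  simp [esymmOn]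

variable [DecidableEq ι]

theorem hsymmOn_zero (s : Finset ι) (f : ι → R) : hsymmOn s 0 f = 1 := by
  simp [hsymmOn]
  rfl

theorem esymmOn_insert_succ {a : ι} {s : Finset ι} (ha : a ∉ s) (m : ℕ) (f : ι → R) :
    esymmOn (insert a s) (m + 1) f = esymmOn s (m + 1) f + f a * esymmOn s m f := by
  have hmem : ∀ t ∈ s.powersetCard m, a ∉ t := fun t ht h =>
    ha ((mem_powersetCard.mp ht).1 h)
  unfold esymmOn
  rw [powersetCard_succ_insert ha, sum_union, sum_image, mul_sum]
  · exact congrArg _ (sum_congr rfl fun t ht => prod_insert (hmem t ht))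
  · intro t ht u hu htu
    rw [← erase_insert (hmem t ht), ← erase_insert (hmem u hu), htu]
  · refine disjoint_left.mpr fun t ht h => ?_
    obtain ⟨u, -, rfl⟩ := mem_image.mp h
    exact ha ((mem_powersetCard.mp ht).1 (mem_insert_self a u))

theorem hsymmOn_insert_succ {a : ι} {s : Finset ι} (ha : a ∉ s) (m : ℕ) (f : ι → R) :
    hsymmOn (insert a s) (m + 1) f = hsymmOn s (m + 1) f + f a * hsymmOn (insert a s) m f := by
  have hsplit : (insert a s).sym (m + 1) =
      s.sym (m + 1) ∪ ((insert a s).sym m).image (Sym.cons a) := by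
    ext t
    simp only [mem_union, mem_image, mem_sym_iff]
    constructor
    · intro h
      by_cases hat : a ∈ t
      · obtain ⟨u, rfl⟩ := Sym.exists_cons_of_mem hat
        exact Or.inr ⟨u, fun b hb => h b (Sym.mem_cons_of_mem hb), rfl⟩
      · refine Or.inl fun b hb => (mem_insert.mp (h b hb)).resolve_left ?_
        rintro rfl
        exact hat hb
    · rintro (h | ⟨u, hu, rfl⟩) b hb
      · exact mem_insert_of_mem (h b hb)
      · rcases Sym.mem_cons.mp hb with rfl | hb
        · exact mem_insert_self _ _
        · exact hu b hb
  unfold hsymmOn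
  rw [hsplit, sum_union, sum_image, mul_sum]
  · simp [Sym.coe_cons]
  · intro t _ u _ htu
    exact Sym.cons_inj_right a t u |>.mp htu
  · refine disjoint_left.mpr fun t ht h => ?_
    obtain ⟨u, -, rfl⟩ := mem_image.mp h
    exact ha (mem_sym_iff.mp ht a (Sym.mem_cons_self a u))

open PowerSeries in
theorem mk_pow_mul_one_sub (a : R) : (PowerSeries.mk fun k => a ^ k) * (1 - C a * X) = 1 := by
  ext n
  rw [mul_sub, mul_one, ← mul_assoc, mul_comm _ (C a), mul_assoc]
  cases n with
  | zero => simp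
  | succ n =>
    simp only [map_sub, coeff_C_mul, coeff_succ_mul_X, coeff_mk, coeff_one]
    simp [pow_succ']

open PowerSeries in
theorem mk_esymmOn_mul_mk_hsymmOn (s : Finset ι) (f : ι → R) :
    (PowerSeries.mk fun m => (-1) ^ m * esymmOn s m f) *
      (PowerSeries.mk fun m => hsymmOn s m f) = 1 ∧
    (PowerSeries.mk fun m => (-1) ^ m * (m * esymmOn s m f)) *
      (PowerSeries.mk fun m => hsymmOn s m f) =
      -PowerSeries.mk fun k => if k = 0 then 0 else ∑ i ∈ s, f i ^ k := by
  induction s using Finset.induction_on with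
  | empty =>
    have hempty (n : ℕ) : esymmOn ∅ (n + 1) f = 0 := by
      rw [esymmOn, powersetCard_eq_empty.mpr (by simp), sum_empty]
    have hE : (PowerSeries.mk fun m => (-1) ^ m * esymmOn (∅ : Finset ι) m f) = 1 := by
      ext n
      cases n <;> simp [hempty, esymmOn_zero, coeff_one]
    have hH : (PowerSeries.mk fun m => hsymmOn (∅ : Finset ι) m f) = 1 := by
      ext n
      cases n with
      | zero => simp [hsymmOn_zero]
      | succ n => simp [hsymmOn, coeff_one]
    have hD : (PowerSeries.mk fun m => (-1) ^ m * (m * esymmOn (∅ : Finset ι) m f)) = 0 := by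
      ext n
      cases n <;> simp [hempty]
    rw [hE, hH, hD]
    refine ⟨one_mul 1, ?_⟩
    ext n
    simp
  | insert a s ha ih =>
    obtain ⟨h1, h2⟩ := ih
    have hE : (PowerSeries.mk fun m => (-1) ^ m * esymmOn (insert a s) m f) =
        (1 - C (f a) * X) * PowerSeries.mk fun m => (-1) ^ m * esymmOn s m f := by
      ext n
      rw [sub_mul, one_mul, mul_assoc]
      cases n with
      | zero => simp [esymmOn_zero]
      | succ n =>
        simp only [map_sub, coeff_C_mul, coeff_succ_X_mul, coeff_mk, esymmOn_insert_succ ha]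
        ring
    have hD : (PowerSeries.mk fun m => (-1) ^ m * (m * esymmOn (insert a s) m f)) =
        (1 - C (f a) * X) * (PowerSeries.mk fun m => (-1) ^ m * (m * esymmOn s m f)) -
          C (f a) * X * PowerSeries.mk fun m => (-1) ^ m * esymmOn s m f := by
      ext n
      rw [sub_mul, one_mul, mul_assoc, mul_assoc]
      cases n with
      | zero => simp
      | succ n =>
        simp only [map_sub, coeff_C_mul, coeff_succ_X_mul, coeff_mk, esymmOn_insert_succ ha]
        push_cast
        ring
    have hH : (1 - C (f a) * X) * (PowerSeries.mk fun m => hsymmOn (insert a s) m f) =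
        PowerSeries.mk fun m => hsymmOn s m f := by
      ext n
      rw [sub_mul, one_mul, mul_assoc]
      cases n with
      | zero => simp [hsymmOn_zero]
      | succ n =>
        simp only [map_sub, coeff_C_mul, coeff_succ_X_mul, coeff_mk, hsymmOn_insert_succ ha]
        ring
    have hG := mk_pow_mul_one_sub (f a)
    have hP : (PowerSeries.mk fun k => if k = 0 then 0 else ∑ i ∈ insert a s, f i ^ k) =
        (PowerSeries.mk fun k => if k = 0 then 0 else ∑ i ∈ s, f i ^ k) +
          C (f a) * X * PowerSeries.mk fun k => f a ^ k := by
      ext n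
      rw [mul_assoc]
      cases n with
      | zero => simp
      | succ n =>
        simp only [map_add, coeff_C_mul, coeff_succ_X_mul, coeff_mk, sum_insert ha]
        simp [pow_succ', add_comm]
    rw [hE, hD, hP]
    generalize (PowerSeries.mk fun m => (-1) ^ m * esymmOn s m f) = E at *
    generalize (PowerSeries.mk fun m => (-1) ^ m * (m * esymmOn s m f)) = D at *
    generalize (PowerSeries.mk fun m => hsymmOn (insert a s) m f) = H' at *
    generalize (PowerSeries.mk fun m => hsymmOn s m f) = H at *
    generalize (PowerSeries.mk fun k => f a ^ k) = G at *
    subst hH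
    refine ⟨by linear_combination h1, ?_⟩
    linear_combination h2 - C (f a) * X * G * h1 + C (f a) * X * E * H' * hG

/-- A Newton-type identity expressing power sums through elementary and complete homogeneous
symmetric functions. -/
theorem sum_mul_esymmOn_mul_hsymmOn (s : Finset ι) (f : ι → R) {k : ℕ} (hk : k ≠ 0) :
    ∑ m ∈ Icc 1 k, (-1) ^ (m - 1) * (m : R) * esymmOn s m f * hsymmOn s (k - m) f =
      ∑ i ∈ s, f i ^ k := by
  have h := congrArg (PowerSeries.coeff k) (mk_esymmOn_mul_mk_hsymmOn s f).2
  rw [PowerSeries.coeff_mul, Nat.sum_antidiagonal_eq_sum_range_succ_mk, sum_range_succ'] at h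
  simp only [PowerSeries.coeff_mk, map_neg, hk, if_false, Nat.cast_zero, zero_mul, mul_zero,
    add_zero] at h
  rw [← neg_eq_iff_eq_neg, ← sum_neg_distrib] at h
  rw [← h, ← Ico_add_one_right_eq_Icc, sum_Ico_eq_sum_range]
  refine sum_congr (by simp) fun m _ => ?_
  rw [add_comm 1 m, Nat.add_sub_cancel]
  ring

end SymmetricFunctions

section BernoulliFunctional

open Polynomial

/-- The linear functional `X ^ m ↦ B_{m+1} / (m + 1)`. -/
noncomputable def bernoulliFunctional : ℚ[X] →ₗ[ℚ] ℚ :=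
  lsum fun m => (_root_.bernoulli (m + 1) / (m + 1)) • LinearMap.id

/-- Integration over `[-1, 0]`, as the linear functional `X ^ m ↦ (-1) ^ m / (m + 1)`. -/
noncomputable def integralNegOneZero : ℚ[X] →ₗ[ℚ] ℚ :=
  lsum fun m => ((-1) ^ m / ((m : ℚ) + 1)) • LinearMap.id

theorem bernoulliFunctional_X_pow (m : ℕ) :
    bernoulliFunctional (X ^ m) = _root_.bernoulli (m + 1) / (m + 1) := by
  simp [bernoulliFunctional, lsum_apply, X_pow_eq_monomial, sum_monomial_index]

theorem integralNegOneZero_X_pow (m : ℕ) :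
    integralNegOneZero (X ^ m) = (-1) ^ m / (m + 1) := by
  simp [integralNegOneZero, lsum_apply, X_pow_eq_monomial, sum_monomial_index]

theorem sum_choose_mul_bernoulli_succ_div (m : ℕ) :
    ∑ l ∈ range (m + 1), (m.choose l : ℚ) * (_root_.bernoulli (l + 1) / (l + 1)) =
      (_root_.bernoulli (m + 1) + (if m = 0 then 1 else 0) - 1) / (m + 1) := by
  have h := _root_.sum_bernoulli (m + 1)
  have h' : ∑ l ∈ range (m + 2), ((m + 1).choose l : ℚ) * _root_.bernoulli l =
      _root_.bernoulli (m + 1) + if m = 0 then 1 else 0 := by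
    rw [sum_range_succ, h]
    simp [add_comm]
  rw [sum_range_succ'] at h'
  have hm : (m : ℚ) + 1 ≠ 0 := by positivity
  rw [eq_div_iff hm, ← h', sum_mul]
  simp only [Nat.choose_zero_right, Nat.cast_one, _root_.bernoulli_zero, mul_one,
    add_sub_cancel_right]
  refine sum_congr rfl fun l _ => ?_
  have hl : (l : ℚ) + 1 ≠ 0 := by positivity
  have hc : ((m : ℚ) + 1) * m.choose l = (m + 1).choose (l + 1) * (l + 1) := by
    exact_mod_cast Nat.add_one_mul_choose_eq m l
  field_simp
  linear_combination _root_.bernoulli (l + 1) * hc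

theorem bernoulliFunctional_reflect_X_pow (m : ℕ) :
    bernoulliFunctional (X ^ m) + bernoulliFunctional ((-1 - X) ^ m) =
      -integralNegOneZero (X ^ m) := by
  have hexp : ((-1 - X : ℚ[X]) ^ m) =
      ∑ l ∈ range (m + 1), ((-1) ^ m * (m.choose l : ℚ)) • X ^ l := by
    rw [show (-1 - X : ℚ[X]) = -1 * (X + 1) by ring, mul_pow, add_pow, mul_sum]
    refine sum_congr rfl fun l _ => ?_
    rw [smul_eq_C_mul]
    simp
    ring
  rw [hexp, map_sum]
  simp only [map_smul, smul_eq_mul, bernoulliFunctional_X_pow, integralNegOneZero_X_pow, mul_assoc]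
  rw [← mul_sum, sum_choose_mul_bernoulli_succ_div]
  rcases Nat.even_or_odd m with hm | hm
  · rcases eq_or_ne m 0 with rfl | h0
    · norm_num
    · have hB : _root_.bernoulli (m + 1) = 0 :=
        bernoulli_eq_zero_of_odd hm.add_one (by omega)
      simp [hB, h0, hm.neg_one_pow, neg_div]
  · have h0 : m ≠ 0 := by rintro rfl; simp at hm
    simp [h0, hm.neg_one_pow]
    ring

theorem bernoulliFunctional_add_comp (p : ℚ[X]) :
    bernoulliFunctional p + bernoulliFunctional (p.comp (-1 - X)) = -integralNegOneZero p := by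
  induction p using Polynomial.induction_on' with
  | add p q hp hq =>
    simp only [add_comp, map_add]
    linear_combination hp + hq
  | monomial m a =>
    rw [← smul_X_eq_monomial, smul_comp, X_pow_comp]
    simp only [map_smul, smul_eq_mul]
    linear_combination a * bernoulliFunctional_reflect_X_pow m

theorem integralNegOneZero_X_pow_mul (i j : ℕ) :
    integralNegOneZero (X ^ i * (X + 1) ^ j) =
      (-1) ^ i * (i.factorial * j.factorial / (i + j + 1).factorial : ℚ) := by
  induction j generalizing i with
  | zero =>
    have h : (i.factorial : ℚ) ≠ 0 := by positivity
    have h' : (i : ℚ) + 1 ≠ 0 := by positivity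
    simp only [pow_zero, mul_one, integralNegOneZero_X_pow, add_zero, Nat.factorial_succ]
    push_cast
    simp only [Nat.factorial_zero, Nat.cast_one]
    field_simp
  | succ j ih =>
    rw [show (X : ℚ[X]) ^ i * (X + 1) ^ (j + 1) =
      X ^ (i + 1) * (X + 1) ^ j + X ^ i * (X + 1) ^ j by ring, map_add, ih, ih,
      show i + 1 + j + 1 = (i + j + 1) + 1 by ring, show i + (j + 1) + 1 = (i + j + 1) + 1 by ring,
      Nat.factorial_succ (i + j + 1), Nat.factorial_succ i, Nat.factorial_succ j]
    have h : ((i + j + 1).factorial : ℚ) ≠ 0 := by positivity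
    have h' : (i : ℚ) + j + 1 + 1 ≠ 0 := by positivity
    push_cast
    field_simp
    ring

theorem sum_choose_mul_bernoulli_div (k : ℕ) :
    ∑ j ∈ range (k + 1), (k.choose j : ℚ) * (_root_.bernoulli (k + j + 1) / (k + j + 1)) =
      -((-1) ^ k / ((k + 1) * ((2 * k + 2).choose (k + 1) : ℚ))) := by
  have hexp : (X : ℚ[X]) ^ k * (X + 1) ^ k =
      ∑ j ∈ range (k + 1), (k.choose j : ℚ) • X ^ (k + j) := by
    rw [add_pow, mul_sum]
    refine sum_congr rfl fun l _ => ?_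
    rw [smul_eq_C_mul, pow_add]
    simp
    ring
  have hL : bernoulliFunctional (X ^ k * (X + 1) ^ k) = ∑ j ∈ range (k + 1),
      (k.choose j : ℚ) * (_root_.bernoulli (k + j + 1) / (k + j + 1)) := by
    rw [hexp, map_sum]
    simp [bernoulliFunctional_X_pow]
  have hcomp : (X ^ k * (X + 1) ^ k : ℚ[X]).comp (-1 - X) = X ^ k * (X + 1) ^ k := by
    rw [← mul_pow, pow_comp]
    congr 1
    simp
    ring
  have h := bernoulliFunctional_add_comp (X ^ k * (X + 1) ^ k)
  rw [hcomp, integralNegOneZero_X_pow_mul, hL] at h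
  have hc : (((2 * k + 2).choose (k + 1) : ℕ) : ℚ) =
      (2 * k + 2).factorial / ((k + 1).factorial * (k + 1).factorial) := by
    rw [Nat.cast_choose ℚ (by omega), show 2 * k + 2 - (k + 1) = k + 1 by omega]
  rw [hc, Nat.factorial_succ (2 * k + 1), Nat.factorial_succ k]
  rw [show k + k + 1 = 2 * k + 1 by ring] at h
  have h1 : (k.factorial : ℚ) ≠ 0 := by positivity
  have h2 : ((2 * k + 1).factorial : ℚ) ≠ 0 := by positivity
  have h3 : (k : ℚ) + 1 ≠ 0 := by positivity
  push_cast
  rw [← mul_right_inj' (two_ne_zero' ℚ), two_mul, h]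
  field_simp
  ring

end BernoulliFunctional

theorem sum_Icc_mul_add_one_pow {k : ℕ} (hk : k ≠ 0) (n : ℕ) :
    ∑ i ∈ Icc 1 n, ((i : ℚ) * (i + 1)) ^ k =
      ∑ j ∈ range (k + 1), (k.choose j : ℚ) *
        (((Polynomial.bernoulli (k + j + 1)).eval ((n : ℚ) + 1) - bernoulli (k + j + 1)) /
          (k + j + 1)) := by
  have hpow : ∀ j : ℕ, ((Polynomial.bernoulli (k + j + 1)).eval ((n : ℚ) + 1) -
      bernoulli (k + j + 1)) / (k + j + 1) = ∑ i ∈ Icc 1 n, (i : ℚ) ^ (k + j) := by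
    intro j
    have h := Polynomial.sum_range_pow_eq_bernoulli_sub (n + 1) (k + j)
    have hne : (k : ℚ) + j + 1 ≠ 0 := by positivity
    push_cast at h
    rw [div_eq_iff hne, ← h, range_eq_Ico, sum_eq_sum_Ico_succ_bot (by omega),
      ← Ico_add_one_right_eq_Icc]
    simp [hk, mul_comm]
  simp only [hpow, mul_sum]
  rw [sum_comm]
  refine sum_congr rfl fun i _ => ?_
  rw [mul_pow, add_pow, mul_sum]
  refine sum_congr rfl fun j _ => ?_
  rw [one_pow, pow_add]
  ring

/-- For `n ≥ 1`, `k ≥ 1`,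
`∑_{m=1}^{k} (-1)^{m-1} m 2^k σ_m(T_1,…,T_n) h_{k-m}(T_1,…,T_n)
= (-1)^k/((k+1)C(2k+2,k+1)) + ∑_{j=0}^{k} C(k,j) B_{k+j+1}(n+1)/(k+j+1)`,
where `T_j = j(j+1)/2` and `B_m` is the `m`-th Bernoulli polynomial. -/
theorem legendre_stirling_bernoulli (n k : ℕ) (hn : 1 ≤ n) (hk : 1 ≤ k) :
    ∑ m ∈ Finset.Icc 1 k, (-1) ^ (m - 1) * (m : ℚ) * 2 ^ k *
        esymmOn (Finset.Icc 1 n) m (fun j => (j : ℚ) * (j + 1) / 2) *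
        hsymmOn (Finset.Icc 1 n) (k - m) (fun j => (j : ℚ) * (j + 1) / 2) =
      (-1) ^ k / ((k + 1) * (Nat.choose (2 * k + 2) (k + 1) : ℚ)) +
        ∑ j ∈ Finset.range (k + 1), (Nat.choose k j : ℚ) *
          (Polynomial.bernoulli (k + j + 1)).eval ((n : ℚ) + 1) / (k + j + 1) := by
  have hnewton := sum_mul_esymmOn_mul_hsymmOn (Finset.Icc 1 n)
    (fun j : ℕ => (j : ℚ) * (j + 1) / 2) (k := k) (by omega)
  calc _ = 2 ^ k * ∑ i ∈ Finset.Icc 1 n, ((i : ℚ) * (i + 1) / 2) ^ k := by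
        rw [← hnewton, mul_sum]
        exact sum_congr rfl fun m _ => by ring
    _ = ∑ i ∈ Finset.Icc 1 n, ((i : ℚ) * (i + 1)) ^ k := by
        rw [mul_sum]
        refine sum_congr rfl fun i _ => ?_
        rw [← mul_pow]
        ring
    _ = _ := by
        rw [sum_Icc_mul_add_one_pow (by omega), ← neg_eq_iff_eq_neg.mpr
          (sum_choose_mul_bernoulli_div k), ← sum_neg_distrib, ← sum_add_distrib]
        exact sum_congr rfl fun j _ => by ring
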